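/- arXiv:1608.04481 — 2 statements merged into one kernel-verified Lean document; each statement's English description precedes it below -/
import Mathlib

section
/- The expected squared Frobenius error of the BasicMatrixMultiplication sketch satisfies the exact identity ∫ ‖A·B − CR(ω)‖_F² ∂μ = ∑_{k : Fin n} ‖A^(k)‖²·‖B_(k)‖²/(c·q k) − (1/c)·‖A·B‖_F². Moreover, if ‖A^(k)‖·‖B_(k)‖ > 0 for every k and q k = ‖A^(k)‖·‖B_(k)‖ / ∑_{k'} ‖A^(k')‖·‖B_(k')‖ for every k, then ∫ ‖A·B − CR(ω)‖_F² ∂μ = (1/c)·(∑_{k : Fin n} ‖A^(k)‖·‖B_(k)‖)² − (1/c)·‖A·B‖_F². -/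
open MeasureTheory

/-- Frobenius norm of a real matrix. -/
noncomputable def frobNorm {m p : ℕ} (M : Matrix (Fin m) (Fin p) ℝ) : ℝ :=
  Real.sqrt (∑ i, ∑ j, (M i j) ^ 2)

/-- Euclidean norm of a vector. -/
noncomputable def vecNorm {m : ℕ} (v : Fin m → ℝ) : ℝ :=
  Real.sqrt (∑ i, (v i) ^ 2)

/-- The `BasicMatrixMultiplication` sketch. -/
noncomputable def CRsketch {m n p c : ℕ} (A : Matrix (Fin m) (Fin n) ℝ)
    (B : Matrix (Fin n) (Fin p) ℝ) (q : Fin n → ℝ) (ω : Fin c → Fin n) :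
    Matrix (Fin m) (Fin p) ℝ :=
  ∑ t : Fin c, (1 / ((c : ℝ) * q (ω t))) • Matrix.vecMulVec (fun i => A i (ω t)) (B (ω t))

lemma frobNorm_sq {m p : ℕ} (M : Matrix (Fin m) (Fin p) ℝ) :
    frobNorm M ^ 2 = ∑ i, ∑ j, M i j ^ 2 :=
  Real.sq_sqrt (by positivity)

lemma vecNorm_sq {m : ℕ} (v : Fin m → ℝ) : vecNorm v ^ 2 = ∑ i, v i ^ 2 :=
  Real.sq_sqrt (by positivity)

lemma CRsketch_apply {m n p c : ℕ} (A : Matrix (Fin m) (Fin n) ℝ)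
    (B : Matrix (Fin n) (Fin p) ℝ) (q : Fin n → ℝ) (ω : Fin c → Fin n) (i : Fin m) (j : Fin p) :
    CRsketch A B q ω i j = ∑ t, A i (ω t) * B (ω t) j / (c * q (ω t)) := by
  simp only [CRsketch, Matrix.sum_apply, Matrix.smul_apply, Matrix.vecMulVec_apply, smul_eq_mul]
  exact Finset.sum_congr rfl fun _ _ => by ring

/-- The mean squared deviation of a sum of i.i.d. copies of `f` from its mean. -/
lemma integral_sq_mean_sub_sum_pi {ι Ω : Type*} [Fintype ι] [MeasurableSpace Ω] (ν : Measure Ω)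
    [IsProbabilityMeasure ν] {f : Ω → ℝ} (hf : MemLp f 2 ν) :
    ∫ ω, (Fintype.card ι * ∫ x, f x ∂ν - ∑ t : ι, f (ω t)) ^ 2 ∂(Measure.pi fun _ : ι => ν) =
      Fintype.card ι * ProbabilityTheory.variance f ν := by
  have hint (t : ι) : Integrable (fun ω : ι → Ω => f (ω t)) (Measure.pi fun _ => ν) :=
    integrable_comp_eval (μ := fun _ : ι => ν) (hf.integrable (by norm_num))
  have hmean : ∫ ω : ι → Ω, ∑ t, f (ω t) ∂(Measure.pi fun _ => ν) =
      Fintype.card ι * ∫ x, f x ∂ν := by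
    rw [integral_finsetSum _ fun t _ => hint t]
    simp [integral_comp_eval (μ := fun _ : ι => ν) hf.aestronglyMeasurable]
  have hvar := ProbabilityTheory.variance_sum_pi (μ := fun _ : ι => ν) (X := fun _ => f)
    fun _ => hf
  have hsum : (∑ t : ι, fun ω : ι → Ω => f (ω t)) = fun ω => ∑ t, f (ω t) := by
    ext ω; simp
  rw [hsum, ProbabilityTheory.variance_eq_integral
    (integrable_finsetSum _ fun t _ => hint t).aemeasurable, hmean] at hvar
  simp only [Finset.sum_const, Finset.card_univ, nsmul_eq_mul] at hvar
  rw [← hvar]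
  exact integral_congr_ae (.of_forall fun ω => sub_sq_comm _ _)

/-- The mean squared error of a single entry of the sketch. -/
lemma integral_sq_mul_sub_CRsketch_apply {m n p c : ℕ} (hc : 0 < c)
    (A : Matrix (Fin m) (Fin n) ℝ) (B : Matrix (Fin n) (Fin p) ℝ)
    (q : Fin n → ℝ) (hq : ∀ k, 0 < q k) (ν : Measure (Fin n)) [IsProbabilityMeasure ν]
    (hν : ∀ k, ν {k} = ENNReal.ofReal (q k)) (i : Fin m) (j : Fin p) :
    ∫ ω, (A * B - CRsketch A B q ω) i j ^ 2 ∂(Measure.pi fun _ : Fin c => ν) =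
      (∑ k, A i k ^ 2 * B k j ^ 2 / (c * q k)) - 1 / c * (A * B) i j ^ 2 := by
  have hc' : (c : ℝ) ≠ 0 := by positivity
  have hq' (k : Fin n) : q k ≠ 0 := (hq k).ne'
  have hint (g : Fin n → ℝ) : ∫ k, g k ∂ν = ∑ k, q k * g k := by
    rw [integral_fintype .of_finite]
    simp [measureReal_def, hν, (hq _).le]
  have hmean : (c : ℝ) * ∫ k, A i k * B k j / (c * q k) ∂ν = (A * B) i j := by
    rw [hint, Matrix.mul_apply, Finset.mul_sum]
    refine Finset.sum_congr rfl fun k _ => ?_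
    have := hq' k
    field_simp
  have h := integral_sq_mean_sub_sum_pi (ι := Fin c) ν
    (f := fun k => A i k * B k j / (c * q k)) .of_discrete
  rw [Fintype.card_fin, hmean, ProbabilityTheory.variance_eq_sub .of_discrete,
    eq_div_of_mul_eq hc' ((mul_comm _ _).trans hmean)] at h
  simp only [Matrix.sub_apply, CRsketch_apply]
  rw [h, hint, mul_sub, Finset.mul_sum]
  congr 1
  · refine Finset.sum_congr rfl fun k _ => ?_
    have := hq' k
    simp only [Pi.pow_apply]
    field_simp
  · field_simp

/-- The exact mean squared Frobenius error of the sketch. -/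
lemma integral_frobNorm_sq_mul_sub_CRsketch {m n p c : ℕ} (hc : 0 < c)
    (A : Matrix (Fin m) (Fin n) ℝ) (B : Matrix (Fin n) (Fin p) ℝ)
    (q : Fin n → ℝ) (hq : ∀ k, 0 < q k) (ν : Measure (Fin n)) [IsProbabilityMeasure ν]
    (hν : ∀ k, ν {k} = ENNReal.ofReal (q k)) :
    ∫ ω, frobNorm (A * B - CRsketch A B q ω) ^ 2 ∂(Measure.pi fun _ : Fin c => ν) =
      (∑ k, vecNorm (fun i => A i k) ^ 2 * vecNorm (B k) ^ 2 / ((c : ℝ) * q k))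
        - (1 / (c : ℝ)) * frobNorm (A * B) ^ 2 := by
  simp only [frobNorm_sq, vecNorm_sq]
  rw [integral_finsetSum _ fun _ _ => .of_finite]
  simp_rw [integral_finsetSum Finset.univ fun _ _ => Integrable.of_finite,
    integral_sq_mul_sub_CRsketch_apply hc A B q hq ν hν, Finset.sum_sub_distrib, ← Finset.mul_sum]
  congr 1
  simp_rw [Finset.sum_mul_sum, Finset.sum_div]
  exact (Finset.sum_congr rfl fun i _ => Finset.sum_comm).trans Finset.sum_comm

theorem stmt_1 {m n p c : ℕ} (hm : 0 < m) (hn : 0 < n) (hp : 0 < p) (hc : 0 < c)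
    (A : Matrix (Fin m) (Fin n) ℝ) (B : Matrix (Fin n) (Fin p) ℝ)
    (q : Fin n → ℝ) (hq : ∀ k, 0 < q k) (hq1 : ∑ k, q k = 1)
    (ν : Measure (Fin n)) [IsProbabilityMeasure ν]
    (hν : ∀ k, ν {k} = ENNReal.ofReal (q k))
    (μ : Measure (Fin c → Fin n)) (hμ : μ = Measure.pi fun _ => ν) :
    (∫ ω, frobNorm (A * B - CRsketch A B q ω) ^ 2 ∂μ) =
      (∑ k, vecNorm (fun i => A i k) ^ 2 * vecNorm (B k) ^ 2 / ((c : ℝ) * q k))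
        - (1 / (c : ℝ)) * frobNorm (A * B) ^ 2 ∧
    ((∀ k, 0 < vecNorm (fun i => A i k) * vecNorm (B k)) →
      (∀ k, q k = vecNorm (fun i => A i k) * vecNorm (B k) /
          ∑ k', vecNorm (fun i => A i k') * vecNorm (B k')) →
      (∫ ω, frobNorm (A * B - CRsketch A B q ω) ^ 2 ∂μ) =
        (1 / (c : ℝ)) * (∑ k, vecNorm (fun i => A i k) * vecNorm (B k)) ^ 2
          - (1 / (c : ℝ)) * frobNorm (A * B) ^ 2) := by
  subst hμ
  have h := integral_frobNorm_sq_mul_sub_CRsketch hc A B q hq ν hν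
  refine ⟨h, fun hpos hqk => ?_⟩
  rw [h, pow_two (∑ k, _), Finset.mul_sum, Finset.mul_sum]
  congr 1
  refine Finset.sum_congr rfl fun k _ => ?_
  have hS : 0 < ∑ k', vecNorm (fun i => A i k') * vecNorm (B k') :=
    Finset.sum_pos (fun k _ => hpos k) ⟨k, Finset.mem_univ k⟩
  have hk := (hpos k).ne'
  rw [← mul_pow, hqk k]
  field_simp
end

section
/- LinearTimeSVD spectral-norm theorem: for every D : Matrix (Fin m) (Fin n) ℝ with Matrix.rank D ≤ k, ‖A − H·Hᵀ·A‖₂² ≤ ‖A − D‖₂² + 2·‖A·Aᵀ − C·Cᵀ‖₂; that is, the squared spectral-norm error of projecting A onto the top-k left singular vectors of C exceeds the optimal rank-k squared error by at most 2‖AAᵀ − CCᵀ‖₂. -/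
open Matrix

/-- Spectral norm (`ℓ₂ → ℓ₂` operator norm, largest singular value) of a real matrix. -/
noncomputable def specNorm {m n : ℕ} (M : Matrix (Fin m) (Fin n) ℝ) : ℝ :=
  ‖(Matrix.toEuclideanLin M).toContinuousLinearMap‖

open scoped Matrix.Norms.L2Operator in
theorem specNorm_eq_norm {m n : ℕ} (M : Matrix (Fin m) (Fin n) ℝ) : specNorm M = ‖M‖ := rfl

theorem specNorm_nonneg {m n : ℕ} (M : Matrix (Fin m) (Fin n) ℝ) : 0 ≤ specNorm M :=
  norm_nonneg _

open scoped Matrix.Norms.L2Operator in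
theorem specNorm_transpose {m n : ℕ} (M : Matrix (Fin m) (Fin n) ℝ) :
    specNorm Mᵀ = specNorm M := by
  rw [specNorm_eq_norm, specNorm_eq_norm, ← conjTranspose_eq_transpose_of_trivial,
    l2_opNorm_conjTranspose]

theorem dotProduct_self_eq_norm_sq {n : ℕ} (x : Fin n → ℝ) :
    x ⬝ᵥ x = ‖WithLp.toLp 2 x‖ ^ 2 := by
  rw [EuclideanSpace.real_norm_sq_eq]
  simp only [dotProduct, sq]

theorem norm_mulVec_le_specNorm {m n : ℕ} (M : Matrix (Fin m) (Fin n) ℝ) (x : Fin n → ℝ) :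
    ‖WithLp.toLp 2 (M *ᵥ x)‖ ≤ specNorm M * ‖WithLp.toLp 2 x‖ :=
  (Matrix.toEuclideanLin M).toContinuousLinearMap.le_opNorm (WithLp.toLp 2 x)

theorem mulVec_dotProduct_mulVec_le {m n : ℕ} (M : Matrix (Fin m) (Fin n) ℝ) (x : Fin n → ℝ) :
    (M *ᵥ x) ⬝ᵥ (M *ᵥ x) ≤ specNorm M ^ 2 * (x ⬝ᵥ x) := by
  rw [dotProduct_self_eq_norm_sq, dotProduct_self_eq_norm_sq, ← mul_pow]
  gcongr
  exact norm_mulVec_le_specNorm M x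

theorem abs_dotProduct_mulVec_le {n : ℕ} (M : Matrix (Fin n) (Fin n) ℝ) (x : Fin n → ℝ) :
    |x ⬝ᵥ (M *ᵥ x)| ≤ specNorm M * (x ⬝ᵥ x) := by
  have h := abs_real_inner_le_norm (WithLp.toLp 2 (M *ᵥ x)) (WithLp.toLp 2 x)
  rw [EuclideanSpace.inner_toLp_toLp, star_trivial] at h
  rw [dotProduct_self_eq_norm_sq]
  nlinarith [norm_mulVec_le_specNorm M x, norm_nonneg (WithLp.toLp 2 x)]

theorem specNorm_sq_le {m n : ℕ} (M : Matrix (Fin m) (Fin n) ℝ) {K : ℝ} (hK : 0 ≤ K)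
    (h : ∀ x, (M *ᵥ x) ⬝ᵥ (M *ᵥ x) ≤ K * (x ⬝ᵥ x)) : specNorm M ^ 2 ≤ K := by
  have hle : specNorm M ≤ √K := by
    refine ContinuousLinearMap.opNorm_le_bound _ (Real.sqrt_nonneg _) fun x => ?_
    have hx := h x.ofLp
    rw [dotProduct_self_eq_norm_sq, dotProduct_self_eq_norm_sq] at hx
    refine (sq_le_sq₀ (norm_nonneg _) (by positivity)).mp ?_
    rw [mul_pow, Real.sq_sqrt hK]
    exact hx
  calc specNorm M ^ 2 ≤ √K ^ 2 := by gcongr; exact specNorm_nonneg M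
    _ = K := Real.sq_sqrt hK

theorem mulVec_dotProduct_mulVec_self {m n : ℕ} (M : Matrix (Fin m) (Fin n) ℝ) (x : Fin n → ℝ) :
    (M *ᵥ x) ⬝ᵥ (M *ᵥ x) = x ⬝ᵥ ((Mᵀ * M) *ᵥ x) := by
  rw [← mulVec_mulVec, dotProduct_mulVec x, vecMul_transpose]

/-- The quadratic forms of `A * Aᵀ` and `C * Cᵀ` differ by at most `specNorm (A * Aᵀ - C * Cᵀ)`. -/
theorem abs_transpose_mulVec_sub_le {m n c : ℕ} (A : Matrix (Fin m) (Fin n) ℝ)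
    (C : Matrix (Fin m) (Fin c) ℝ) (z : Fin m → ℝ) :
    |(Aᵀ *ᵥ z) ⬝ᵥ (Aᵀ *ᵥ z) - (Cᵀ *ᵥ z) ⬝ᵥ (Cᵀ *ᵥ z)| ≤
      specNorm (A * Aᵀ - C * Cᵀ) * (z ⬝ᵥ z) := by
  have h := abs_dotProduct_mulVec_le (A * Aᵀ - C * Cᵀ) z
  rwa [sub_mulVec, dotProduct_sub, ← transpose_transpose A, ← transpose_transpose C,
    transpose_transpose Aᵀ, transpose_transpose Cᵀ, ← mulVec_dotProduct_mulVec_self,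
    ← mulVec_dotProduct_mulVec_self, transpose_transpose, transpose_transpose] at h

theorem exists_mulVec_eq_zero_of_rank_lt {m n : ℕ} (M : Matrix (Fin m) (Fin n) ℝ)
    (h : M.rank < n) : ∃ a ≠ 0, M *ᵥ a = 0 := by
  by_contra! hne
  have hinj : Function.Injective M.mulVecLin := by
    rw [← LinearMap.ker_eq_bot, LinearMap.ker_eq_bot']
    intro a ha
    by_contra h0
    exact hne a h0 ha
  have := LinearMap.finrank_range_of_inj hinj
  rw [Module.finrank_fin_fun] at this
  exact h.ne this

section Spectral

variable {m c : ℕ} {C : Matrix (Fin m) (Fin c) ℝ} {Q : Matrix (Fin c) (Fin c) ℝ} {σ : Fin c → ℝ}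

theorem mulVec_transpose_dotProduct_self (hQ : Q * Qᵀ = 1)
    (hC : Cᵀ * C * Qᵀ = Qᵀ * diagonal fun t => σ t ^ 2) (b : Fin c → ℝ) :
    (C *ᵥ (Qᵀ *ᵥ b)) ⬝ᵥ (C *ᵥ (Qᵀ *ᵥ b)) = ∑ t, σ t ^ 2 * b t ^ 2 := by
  rw [mulVec_mulVec, mulVec_dotProduct_mulVec_self, transpose_mul, transpose_transpose,
    Matrix.mul_assoc, ← Matrix.mul_assoc Cᵀ, hC, ← Matrix.mul_assoc, hQ, Matrix.one_mul]
  simp only [dotProduct, mulVec_diagonal]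
  exact Finset.sum_congr rfl fun t _ => by ring

theorem transpose_mulVec_mulVec_dotProduct_self (hQ : Q * Qᵀ = 1)
    (hC : Cᵀ * C * Qᵀ = Qᵀ * diagonal fun t => σ t ^ 2) (b : Fin c → ℝ) :
    (Cᵀ *ᵥ (C *ᵥ (Qᵀ *ᵥ b))) ⬝ᵥ (Cᵀ *ᵥ (C *ᵥ (Qᵀ *ᵥ b))) = ∑ t, σ t ^ 4 * b t ^ 2 := by
  rw [mulVec_mulVec, mulVec_mulVec, hC, ← mulVec_mulVec,
    mulVec_dotProduct_mulVec_self, transpose_transpose, hQ, one_mulVec]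
  simp only [dotProduct, mulVec_diagonal]
  exact Finset.sum_congr rfl fun t _ => by ring

/-- If `Cᵀ *ᵥ z` only involves right singular vectors with singular value squared at most `τ`,
then its squared norm is at most `τ` times that of `z`. -/
theorem transpose_mulVec_dotProduct_self_le (hQ : Q * Qᵀ = 1)
    (hC : Cᵀ * C * Qᵀ = Qᵀ * diagonal fun t => σ t ^ 2) {τ : ℝ} {z : Fin m → ℝ}
    (h : ∀ t, (Q *ᵥ (Cᵀ *ᵥ z)) t = 0 ∨ σ t ^ 2 ≤ τ) (hτ : 0 ≤ τ) :
    (Cᵀ *ᵥ z) ⬝ᵥ (Cᵀ *ᵥ z) ≤ τ * (z ⬝ᵥ z) := by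
  set u := Cᵀ *ᵥ z with hu
  have hQu : Qᵀ *ᵥ (Q *ᵥ u) = u := by
    rw [mulVec_mulVec, mul_eq_one_comm.mp hQ, one_mulVec]
  have hnorm : u ⬝ᵥ u = ∑ t, (Q *ᵥ u) t ^ 2 := by
    have := mulVec_dotProduct_mulVec_self Q u
    rw [mul_eq_one_comm.mp hQ, one_mulVec] at this
    rw [← this]
    simp only [dotProduct, sq]
  have hCu : (C *ᵥ u) ⬝ᵥ (C *ᵥ u) ≤ τ * (u ⬝ᵥ u) := by
    have := mulVec_transpose_dotProduct_self hQ hC (Q *ᵥ u)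
    rw [hQu] at this
    rw [this, hnorm, Finset.mul_sum]
    refine Finset.sum_le_sum fun t _ => ?_
    rcases h t with h | h
    · simp [h]
    · gcongr
  have hzu : u ⬝ᵥ u = z ⬝ᵥ (C *ᵥ u) := by
    rw [dotProduct_mulVec z, ← mulVec_transpose]
  have hcs : (z ⬝ᵥ (C *ᵥ u)) ^ 2 ≤ (z ⬝ᵥ z) * ((C *ᵥ u) ⬝ᵥ (C *ᵥ u)) := by
    simpa only [dotProduct, sq] using Finset.sum_mul_sq_le_sq_mul_sq Finset.univ z (C *ᵥ u)
  have hz : 0 ≤ z ⬝ᵥ z := by rw [dotProduct_self_eq_norm_sq]; positivity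
  have hu0 : 0 ≤ u ⬝ᵥ u := by rw [dotProduct_self_eq_norm_sq]; positivity
  rcases hu0.eq_or_lt with h0 | h0
  · rw [← h0]; positivity
  · rw [← hzu] at hcs
    refine le_of_mul_le_mul_right ?_ h0
    nlinarith [mul_le_mul_of_nonneg_left hCu hz]

/-- A singular value of `C` of index at least `k`, compared with a rank-`k` approximation of `A`. -/
theorem sq_singularValue_le {n k : ℕ} (hQ : Q * Qᵀ = 1)
    (hC : Cᵀ * C * Qᵀ = Qᵀ * diagonal fun t => σ t ^ 2) (hmono : Antitone σ)
    (hnonneg : ∀ t, 0 ≤ σ t) (A D : Matrix (Fin m) (Fin n) ℝ) (hD : D.rank ≤ k)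
    (t : Fin c) (ht : k ≤ t) :
    σ t ^ 2 ≤ specNorm (A - D) ^ 2 + specNorm (A * Aᵀ - C * Cᵀ) := by
  rcases (hnonneg t).eq_or_lt with h0 | hσ
  · rw [← h0]
    have := specNorm_nonneg (A * Aᵀ - C * Cᵀ)
    rw [zero_pow two_ne_zero]
    positivity
  have hkc : k + 1 ≤ c := by omega
  let P : Matrix (Fin c) (Fin (k + 1)) ℝ := (1 : Matrix (Fin c) (Fin c) ℝ).submatrix id
    (Fin.castLE hkc)
  obtain ⟨a, ha, hDa⟩ := exists_mulVec_eq_zero_of_rank_lt (Dᵀ * (C * (Qᵀ * P))) <| by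
    have := rank_mul_le_left Dᵀ (C * (Qᵀ * P))
    rw [rank_transpose] at this
    omega
  let b := P *ᵥ a
  let w := C *ᵥ (Qᵀ *ᵥ b)
  have hDw : Dᵀ *ᵥ w = 0 := by
    simpa only [w, b, mulVec_mulVec, Matrix.mul_assoc] using hDa
  have hPa (j : Fin (k + 1)) : b (Fin.castLE hkc j) = a j := by
    simp [b, P, mulVec, dotProduct, one_apply]
  have hb (s : Fin c) : b s = 0 ∨ σ t ≤ σ s := by
    rcases lt_or_ge (s : ℕ) (k + 1) with hs | hs
    · exact Or.inr (hmono (Fin.le_def.mpr (by omega)))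
    · left
      change ∑ j, P s j * a j = 0
      refine Finset.sum_eq_zero fun j _ => ?_
      have : s ≠ Fin.castLE hkc j := by
        intro h
        have := congrArg Fin.val h
        simp at this
        omega
      simp [P, one_apply, this]
  have hww : w ⬝ᵥ w = ∑ s, σ s ^ 2 * b s ^ 2 := mulVec_transpose_dotProduct_self hQ hC b
  have hw : 0 < w ⬝ᵥ w := by
    obtain ⟨j, hj⟩ := Function.ne_iff.mp ha
    rw [hww]
    refine Finset.sum_pos' (fun s _ => by positivity) ⟨Fin.castLE hkc j, Finset.mem_univ _, ?_⟩
    have h1 : b (Fin.castLE hkc j) ≠ 0 := by rw [hPa]; exact hj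
    have h2 : 0 < σ (Fin.castLE hkc j) := hσ.trans_le ((hb _).resolve_left h1)
    positivity
  have hlow : σ t ^ 2 * (w ⬝ᵥ w) ≤ (Cᵀ *ᵥ w) ⬝ᵥ (Cᵀ *ᵥ w) := by
    rw [hww, transpose_mulVec_mulVec_dotProduct_self hQ hC b, Finset.mul_sum]
    refine Finset.sum_le_sum fun s _ => ?_
    rcases hb s with h | h
    · simp [h]
    · calc σ t ^ 2 * (σ s ^ 2 * b s ^ 2) ≤ σ s ^ 2 * (σ s ^ 2 * b s ^ 2) := by gcongr
        _ = σ s ^ 4 * b s ^ 2 := by ring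
  have hAw : (Aᵀ *ᵥ w) ⬝ᵥ (Aᵀ *ᵥ w) ≤ specNorm (A - D) ^ 2 * (w ⬝ᵥ w) := by
    have := mulVec_dotProduct_mulVec_le (A - D)ᵀ w
    rwa [specNorm_transpose, transpose_sub, sub_mulVec, hDw, sub_zero] at this
  have hdiff := (abs_le.mp (abs_transpose_mulVec_sub_le A C w)).1
  refine le_of_mul_le_mul_right ?_ hw
  linarith

end Spectral

theorem stmt_17 {m n c k : ℕ} (hm : 0 < m) (hn : 0 < n) (hc : 0 < c) (hk : 0 < k)
    (hkc : k ≤ c)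
    (A : Matrix (Fin m) (Fin n) ℝ) (C : Matrix (Fin m) (Fin c) ℝ)
    (y : Fin c → Fin c → ℝ)
    (horth : ∀ s t, (∑ i, y s i * y t i) = if s = t then (1 : ℝ) else 0)
    (σ : Fin c → ℝ)
    (heig : ∀ t, (Cᵀ * C) *ᵥ y t = (σ t) ^ 2 • y t)
    (hmono : Antitone σ) (hnonneg : ∀ t, 0 ≤ σ t)
    (hpos : ∀ t : Fin c, (t : ℕ) < k → 0 < σ t)
    (H : Matrix (Fin m) (Fin k) ℝ)
    (hH : ∀ (i : Fin m) (t : Fin k),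
      H i t = (σ (Fin.castLE hkc t))⁻¹ * (C *ᵥ y (Fin.castLE hkc t)) i) :
    ∀ D : Matrix (Fin m) (Fin n) ℝ, Matrix.rank D ≤ k →
      specNorm (A - H * Hᵀ * A) ^ 2 ≤
        specNorm (A - D) ^ 2 + 2 * specNorm (A * Aᵀ - C * Cᵀ) := by
  intro D hD
  let Q : Matrix (Fin c) (Fin c) ℝ := of y
  have hQ : Q * Qᵀ = 1 := by
    ext s t
    simpa [Q, mul_apply, one_apply] using horth s t
  have hC : Cᵀ * C * Qᵀ = Qᵀ * diagonal fun t => σ t ^ 2 := by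
    ext i t
    rw [mul_diagonal]
    exact (congrFun (heig t) i).trans (mul_comm _ _)
  have hσ (t : Fin k) : σ (Fin.castLE hkc t) ≠ 0 := (hpos _ t.isLt).ne'
  have hHz (z : Fin m → ℝ) (t : Fin k) :
      (Q *ᵥ (Cᵀ *ᵥ z)) (Fin.castLE hkc t) = σ (Fin.castLE hkc t) * (Hᵀ *ᵥ z) t := by
    have h1 : (Q *ᵥ (Cᵀ *ᵥ z)) (Fin.castLE hkc t) = (C *ᵥ y (Fin.castLE hkc t)) ⬝ᵥ z := by
      change y (Fin.castLE hkc t) ⬝ᵥ (Cᵀ *ᵥ z) = _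
      rw [dotProduct_mulVec, vecMul_transpose]
    have h2 : (Hᵀ *ᵥ z) t = (σ (Fin.castLE hkc t))⁻¹ * ((C *ᵥ y (Fin.castLE hkc t)) ⬝ᵥ z) := by
      rw [dotProduct, Finset.mul_sum]
      change ∑ i, Hᵀ t i * z i = _
      refine Finset.sum_congr rfl fun i _ => ?_
      rw [transpose_apply, hH, mul_assoc]
    rw [h1, h2, mul_inv_cancel_left₀ (hσ t)]
  have hHH : Hᵀ * H = 1 := by
    ext s t
    have hcol : (fun i => H i t) =
        (σ (Fin.castLE hkc t))⁻¹ • (C *ᵥ y (Fin.castLE hkc t)) := by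
      ext i
      simp [hH]
    have h1 := hHz (fun i => H i t) s
    rw [hcol, mulVec_smul, mulVec_mulVec, heig, smul_smul, mulVec_smul] at h1
    have h2 : (Q *ᵥ y (Fin.castLE hkc t)) (Fin.castLE hkc s) = if s = t then 1 else 0 := by
      simpa [Q, mulVec, dotProduct] using horth (Fin.castLE hkc s) (Fin.castLE hkc t)
    rw [← hcol, Pi.smul_apply, h2] at h1
    change (Hᵀ *ᵥ fun i => H i t) s = _
    rw [one_apply]
    refine mul_left_cancel₀ (hσ s) (h1.symm.trans ?_)
    split_ifs with hst
    · subst hst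
      have := hσ s
      simp only [smul_eq_mul]
      field_simp
    · simp
  set τ := specNorm (A - D) ^ 2 + specNorm (A * Aᵀ - C * Cᵀ) with hτ
  have hE := specNorm_nonneg (A * Aᵀ - C * Cᵀ)
  have hτ0 : 0 ≤ τ := by positivity
  rw [← specNorm_transpose (A - H * Hᵀ * A)]
  refine specNorm_sq_le _ (by positivity) fun x => ?_
  set z := x - H *ᵥ (Hᵀ *ᵥ x) with hz
  have hAz : (A - H * Hᵀ * A)ᵀ *ᵥ x = Aᵀ *ᵥ z := by
    rw [hz, transpose_sub, transpose_mul, transpose_mul, transpose_transpose, sub_mulVec,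
      mulVec_sub, mulVec_mulVec, mulVec_mulVec, Matrix.mul_assoc]
  have hHz0 : Hᵀ *ᵥ z = 0 := by
    rw [hz, mulVec_sub, mulVec_mulVec, hHH, one_mulVec, sub_self]
  have hzx : z ⬝ᵥ z ≤ x ⬝ᵥ x := by
    have h1 : z ⬝ᵥ (H *ᵥ (Hᵀ *ᵥ x)) = 0 := by
      rw [dotProduct_mulVec, ← mulVec_transpose, hHz0, zero_dotProduct]
    have h2 : x = z + H *ᵥ (Hᵀ *ᵥ x) := by rw [hz, sub_add_cancel]
    have h3 : 0 ≤ (H *ᵥ (Hᵀ *ᵥ x)) ⬝ᵥ (H *ᵥ (Hᵀ *ᵥ x)) := by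
      rw [dotProduct_self_eq_norm_sq]; positivity
    have h4 : x ⬝ᵥ x = z ⬝ᵥ z + (H *ᵥ (Hᵀ *ᵥ x)) ⬝ᵥ (H *ᵥ (Hᵀ *ᵥ x)) := by
      conv_lhs => rw [h2]
      rw [dotProduct_add, add_dotProduct, add_dotProduct, dotProduct_comm (H *ᵥ _) z, h1]
      ring
    linarith
  have hCz : (Cᵀ *ᵥ z) ⬝ᵥ (Cᵀ *ᵥ z) ≤ τ * (z ⬝ᵥ z) := by
    refine transpose_mulVec_dotProduct_self_le hQ hC (fun t => ?_) hτ0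
    rcases lt_or_ge (t : ℕ) k with h | h
    · left
      simpa [hHz0] using hHz z ⟨t, h⟩
    · exact Or.inr (sq_singularValue_le hQ hC hmono hnonneg A D hD t h)
  have hdiff := (abs_le.mp (abs_transpose_mulVec_sub_le A C z)).2
  rw [hAz]
  calc (Aᵀ *ᵥ z) ⬝ᵥ (Aᵀ *ᵥ z)
      ≤ (specNorm (A - D) ^ 2 + 2 * specNorm (A * Aᵀ - C * Cᵀ)) * (z ⬝ᵥ z) := by
        rw [hτ] at hCz
        linarith
    _ ≤ _ := by gcongr
end
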